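/- (Conjugacy with the golden mean subshift.) Let w : ℤ → {0,1} be an admissible word such that for every K ≥ 0 there exist n ≥ K and m ≥ K with w(n) = w(n+1) = 0 and w(−m) = w(−m+1) = 0 (neither the forward nor the backward tail of w is eventually alternating). Then there exists exactly one bi-infinite f-orbit p : ℤ → ℝ² such that p(n) ∈ R_{w(n)} for every n ∈ ℤ. -/

import Mathlib

open Filter

/-- The birational map f(x,y) = (y(x+a)/(x-1), x+a-1). -/
noncomputable def birat (a : ℝ) (p : ℝ × ℝ) : ℝ × ℝ :=
  (p.2 * (p.1 + a) / (p.1 - 1), p.1 + a - 1)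

/-- The inverse map f⁻¹(x,y) = (y+1-a, x(y-a)/(y+1)). -/
noncomputable def biratInv (a : ℝ) (p : ℝ × ℝ) : ℝ × ℝ :=
  (p.2 + 1 - a, p.1 * (p.2 - a) / (p.2 + 1))

/-- The forward orbit of `p` is defined up to time `n`. -/
def orbitDefined (a : ℝ) (p : ℝ × ℝ) (n : ℕ) : Prop :=
  ∀ k < n, ((birat a)^[k] p).1 ≠ 1

def Rplus : Set (ℝ × ℝ) := {p | p.1 ≤ 1 ∧ p.2 ≤ 0}
def Rminus : Set (ℝ × ℝ) := {p | 0 ≤ p.1 ∧ -1 ≤ p.2}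
def Rzero : Set (ℝ × ℝ) := {p | 1 ≤ p.1 ∧ p.2 ≤ -1}
def Rone : Set (ℝ × ℝ) := {p | p.1 ≤ 0 ∧ 0 ≤ p.2}
def intRplus : Set (ℝ × ℝ) := {p | p.1 < 1 ∧ p.2 < 0}
def intRzero : Set (ℝ × ℝ) := {p | 1 < p.1 ∧ p.2 < -1}
def intRone : Set (ℝ × ℝ) := {p | p.1 < 0 ∧ 0 < p.2}

/-- `Rw 0 = R₀`, `Rw 1 = R₁`. -/
def Rw (i : Fin 2) : Set (ℝ × ℝ) := if i = 0 then Rzero else Rone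

/-- `intRw 0 = int R₀`, `intRw 1 = int R₁`. -/
def intRw (i : Fin 2) : Set (ℝ × ℝ) := if i = 0 then intRzero else intRone

/-- Euclidean distance on ℝ². -/
noncomputable def eucDist (p q : ℝ × ℝ) : ℝ :=
  Real.sqrt ((p.1 - q.1) ^ 2 + (p.2 - q.2) ^ 2)

/-- In the coordinate `t = x - (d + 1)`, with `a = -(2 * d + 1)`, an orbit of `birat a` is a solution
of a second order recurrence, and its itinerary is recorded by the intervals containing each `t n`. -/
structure CodedOrbit (d : ℝ) (w : ℤ → Fin 2) (t : ℤ → ℝ) : Prop where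
  recurrence : ∀ n, (d + t n) * (d + 1 + t (n + 1)) = (d - t n) * (d + 1 - t (n - 1))
  lt_of_one : ∀ n, w n = 1 → t n < -(d + 1)
  gt_of_succ_one : ∀ n, w (n + 1) = 1 → d + 1 < t n
  mid_of_zero : ∀ n, w n = 0 → w (n + 1) = 0 → -d < t n ∧ t n < d

/-- The slope (up to sign) of the line joining `(t (n - 1), t n)` to `(d + 1, -(d + 1))`. -/
noncomputable def pencilSlope (d : ℝ) (t : ℤ → ℝ) (n : ℤ) : ℝ := (d + 1 + t n) / (d + 1 - t (n - 1))

/-- The product of two consecutive slopes, as a function of the middle point. -/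
noncomputable def slopeProd (d t : ℝ) : ℝ := (d - t) * (d + 1 + t) / ((d + t) * (d + 1 - t))

theorem fin_two_cases (i : Fin 2) : i = 0 ∨ i = 1 := by
  fin_cases i <;> simp

theorem slopeProd_den_pos {d t : ℝ} (h1 : -d < t) (h2 : t < d) :
    0 < (d + t) * (d + 1 - t) := mul_pos (by linarith) (by linarith)

theorem slopeProd_den_neg_of_gt {d t : ℝ} (hd : 0 < d) (h : d + 1 < t) :
    (d + t) * (d + 1 - t) < 0 := mul_neg_of_pos_of_neg (by linarith) (by linarith)

theorem slopeProd_den_neg_of_lt {d t : ℝ} (hd : 0 < d) (h : t < -(d + 1)) :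
    (d + t) * (d + 1 - t) < 0 := mul_neg_of_neg_of_pos (by linarith) (by linarith)

theorem slopeProd_cross (d s t : ℝ) :
    (d - s) * (d + 1 + s) * ((d + t) * (d + 1 - t)) -
      (d - t) * (d + 1 + t) * ((d + s) * (d + 1 - s)) =
    2 * (t - s) * ((d + 1) * d + s * t) := by ring

theorem slopeProd_anti {d s t : ℝ} (hden : 0 < ((d + s) * (d + 1 - s)) * ((d + t) * (d + 1 - t)))
    (hprod : 0 ≤ (d + 1) * d + s * t) (hst : s ≤ t) : slopeProd d t ≤ slopeProd d s := by
  have hs : (d + s) * (d + 1 - s) ≠ 0 := left_ne_zero_of_mul hden.ne'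
  have ht : (d + t) * (d + 1 - t) ≠ 0 := right_ne_zero_of_mul hden.ne'
  have : slopeProd d s - slopeProd d t = 2 * (t - s) * ((d + 1) * d + s * t) /
      (((d + s) * (d + 1 - s)) * ((d + t) * (d + 1 - t))) := by
    rw [← slopeProd_cross, slopeProd, slopeProd, div_sub_div _ _ hs ht]
    ring
  have h2 : 0 ≤ slopeProd d s - slopeProd d t := by
    rw [this]
    exact div_nonneg (mul_nonneg (by linarith) hprod) hden.le
  linarith

/-- On the middle interval, `slopeProd` decreases at a definite rate. -/
theorem slopeProd_quant {d s t : ℝ} (hd : 0 < d) (hs : -d < s) (hst : s ≤ t) (ht : t < d) :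
    slopeProd d t * (1 + (t - s) / (2 * d * (2 * d + 1) ^ 2)) ≤ slopeProd d s := by
  have hS := slopeProd_den_pos hs (hst.trans_lt ht)
  have hT := slopeProd_den_pos (hs.trans_le hst) ht
  have hst' : -(d * d) ≤ s * t := by
    nlinarith [mul_pos (sub_pos.2 ht) (neg_lt_iff_pos_add.1 hs),
      mul_pos (sub_pos.2 (hst.trans_lt ht)) (neg_lt_iff_pos_add.1 (hs.trans_le hst))]
  have hv : 0 ≤ t - s := by linarith
  have h1 : (d - t) * (d + s) ≤ (2 * d) * (2 * d) :=
    mul_le_mul (by linarith) (by linarith) (by linarith) (by linarith)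
  have h2 : (d + 1 + t) * (d + 1 - s) ≤ (2 * d + 1) * (2 * d + 1) :=
    mul_le_mul (by linarith) (by linarith) (by linarith) (by linarith)
  have h3 : (d - t) * (d + s) * ((d + 1 + t) * (d + 1 - s)) ≤
      (2 * d) * (2 * d) * ((2 * d + 1) * (2 * d + 1)) :=
    mul_le_mul h1 h2 (mul_nonneg (by linarith) (by linarith)) (by positivity)
  have h4 : (t - s) / (2 * d * (2 * d + 1) ^ 2) *
      ((d - t) * (d + s) * ((d + 1 + t) * (d + 1 - s))) ≤ (t - s) * (2 * d) := by
    calc _ ≤ (t - s) / (2 * d * (2 * d + 1) ^ 2) *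
        ((2 * d) * (2 * d) * ((2 * d + 1) * (2 * d + 1))) :=
          mul_le_mul_of_nonneg_left h3 (by positivity)
      _ = (t - s) * (2 * d) := by field_simp
  have h5 := slopeProd_cross d s t
  have h6 : (t - s) * d ≤ (t - s) * ((d + 1) * d + s * t) :=
    mul_le_mul_of_nonneg_left (by nlinarith) hv
  rw [slopeProd, slopeProd, div_mul_eq_mul_div, div_le_div_iff₀ hT hS]
  nlinarith

namespace CodedOrbit

variable {d : ℝ} {w : ℤ → Fin 2} {t s : ℤ → ℝ}

theorem gt_of_zero (h : CodedOrbit d w t) (hd : 0 < d) {n : ℤ} (hn : w n = 0) : -d < t n := by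
  rcases fin_two_cases (w (n + 1)) with h0 | h1
  · exact (h.mid_of_zero n hn h0).1
  · linarith [h.gt_of_succ_one n h1]

theorem lt_of_succ_zero (h : CodedOrbit d w t) (hd : 0 < d) {n : ℤ} (hn : w (n + 1) = 0) :
    t n < d := by
  rcases fin_two_cases (w n) with h0 | h1
  · exact (h.mid_of_zero n h0 hn).2
  · linarith [h.lt_of_one n h1]

theorem pred_lt_of_zero (h : CodedOrbit d w t) (hd : 0 < d) {n : ℤ} (hn : w n = 0) :
    t (n - 1) < d :=
  h.lt_of_succ_zero hd (by simpa using hn)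

theorem pred_gt_of_one (h : CodedOrbit d w t) {n : ℤ} (hn : w n = 1) : d + 1 < t (n - 1) :=
  h.gt_of_succ_one (n - 1) (by simpa using hn)

theorem reverse (h : CodedOrbit d w t) : CodedOrbit d (fun k => w (1 - k)) (fun k => -t (-k)) where
  recurrence k := by
    have := h.recurrence (-k)
    rw [show -(k + 1) = -k - 1 by ring, show -(k - 1) = -k + 1 by ring]
    linarith
  lt_of_one k hk := by
    have := h.gt_of_succ_one (-k) (by rwa [neg_add_eq_sub])
    linarith
  gt_of_succ_one k hk := by
    have := h.lt_of_one (-k) (by rwa [show 1 - (k + 1) = -k by ring] at hk)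
    linarith
  mid_of_zero k h0 h1 := by
    have := h.mid_of_zero (-k) (by rwa [show 1 - (k + 1) = -k by ring] at h1)
      (by rwa [neg_add_eq_sub])
    constructor <;> linarith

theorem slope_pos (h : CodedOrbit d w t) (hd : 0 < d) (n : ℤ) : 0 < pencilSlope d t n := by
  rcases fin_two_cases (w n) with h0 | h1
  · have := h.gt_of_zero hd h0
    have := h.pred_lt_of_zero hd h0
    exact div_pos (by linarith) (by linarith)
  · have := h.lt_of_one n h1
    have := h.pred_gt_of_one h1
    exact div_pos_of_neg_of_neg (by linarith) (by linarith)

theorem sub_pred_ne_zero (h : CodedOrbit d w t) (hd : 0 < d) (n : ℤ) : d + 1 - t (n - 1) ≠ 0 := by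
  rcases fin_two_cases (w n) with h0 | h1
  · have := h.pred_lt_of_zero hd h0
    linarith
  · have := h.pred_gt_of_one h1
    linarith

theorem slope_mul (h : CodedOrbit d w t) (hd : 0 < d) (n : ℤ) :
    pencilSlope d t n * (d + 1 - t (n - 1)) = d + 1 + t n :=
  div_mul_cancel₀ _ (h.sub_pred_ne_zero hd n)

theorem add_ne_zero (h : CodedOrbit d w t) (hd : 0 < d) (n : ℤ) : d + t n ≠ 0 := by
  rcases fin_two_cases (w n) with h0 | h1
  · linarith [h.gt_of_zero hd h0]
  · linarith [h.lt_of_one n h1]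

theorem sub_ne_zero (h : CodedOrbit d w t) (hd : 0 < d) (n : ℤ) : d + 1 - t n ≠ 0 := by
  simpa using h.sub_pred_ne_zero hd (n + 1)

theorem slope_succ_mul (h : CodedOrbit d w t) (hd : 0 < d) (n : ℤ) :
    pencilSlope d t (n + 1) * pencilSlope d t n = slopeProd d (t n) := by
  have h1 := h.sub_pred_ne_zero hd n
  have h2 := h.sub_ne_zero hd n
  have h3 := h.add_ne_zero hd n
  have h4 := h.recurrence n
  rw [pencilSlope, pencilSlope, slopeProd, add_sub_cancel_right, div_mul_div_comm,
    div_eq_div_iff (mul_ne_zero h2 h1) (mul_ne_zero h3 h2)]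
  linear_combination (d + 1 + t n) * (d + 1 - t n) * h4

theorem slopeProd_le (ht : CodedOrbit d w t) (hs : CodedOrbit d w s) (hd : 0 < d) {n : ℤ}
    (hst : s n ≤ t n) : slopeProd d (t n) ≤ slopeProd d (s n) := by
  rcases fin_two_cases (w n) with h0 | h1
  · rcases fin_two_cases (w (n + 1)) with h0' | h1'
    · obtain ⟨a1, a2⟩ := ht.mid_of_zero n h0 h0'
      obtain ⟨b1, b2⟩ := hs.mid_of_zero n h0 h0'
      refine slopeProd_anti (mul_pos (slopeProd_den_pos b1 b2) (slopeProd_den_pos a1 a2)) ?_ hst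
      nlinarith [mul_pos (sub_pos.2 a2) (neg_lt_iff_pos_add.1 b1),
        mul_pos (sub_pos.2 b2) (neg_lt_iff_pos_add.1 a1)]
    · have a := ht.gt_of_succ_one n h1'
      have b := hs.gt_of_succ_one n h1'
      refine slopeProd_anti (mul_pos_of_neg_of_neg (slopeProd_den_neg_of_gt hd b)
        (slopeProd_den_neg_of_gt hd a)) ?_ hst
      have : 0 < s n * t n := mul_pos (by linarith) (by linarith)
      positivity
  · have a := ht.lt_of_one n h1
    have b := hs.lt_of_one n h1
    refine slopeProd_anti (mul_pos_of_neg_of_neg (slopeProd_den_neg_of_lt hd b)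
      (slopeProd_den_neg_of_lt hd a)) ?_ hst
    have : 0 < s n * t n := mul_pos_of_neg_of_neg (by linarith) (by linarith)
    positivity

theorem slope_succ_le (ht : CodedOrbit d w t) (hs : CodedOrbit d w s) (hd : 0 < d) {n : ℤ}
    {r q : ℝ} (hr : 0 ≤ r) (hslope : r * pencilSlope d s n ≤ pencilSlope d t n)
    (hprod : slopeProd d (t n) * q ≤ slopeProd d (s n)) :
    r * q * pencilSlope d t (n + 1) ≤ pencilSlope d s (n + 1) := by
  have h1 := ht.slope_pos hd n
  have h2 := hs.slope_pos hd n
  have h3 := ht.slope_pos hd (n + 1)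
  have h4 := hs.slope_pos hd (n + 1)
  rw [← ht.slope_succ_mul hd, ← hs.slope_succ_mul hd] at hprod
  refine le_of_mul_le_mul_right ?_ h1
  calc r * q * pencilSlope d t (n + 1) * pencilSlope d t n
      = r * (pencilSlope d t (n + 1) * pencilSlope d t n * q) := by ring
    _ ≤ r * (pencilSlope d s (n + 1) * pencilSlope d s n) := mul_le_mul_of_nonneg_left hprod hr
    _ = pencilSlope d s (n + 1) * (r * pencilSlope d s n) := by ring
    _ ≤ pencilSlope d s (n + 1) * pencilSlope d t n := mul_le_mul_of_nonneg_left hslope h4.le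

theorem mul_add_le (ht : CodedOrbit d w t) (hs : CodedOrbit d w s) (hd : 0 < d) {n : ℤ} {r : ℝ}
    (hn : w n = 0) (hpred : t (n - 1) ≤ s (n - 1))
    (hslope : r * pencilSlope d s n ≤ pencilSlope d t n) :
    r * (d + 1 + s n) ≤ d + 1 + t n := by
  rw [← ht.slope_mul hd, ← hs.slope_mul hd, ← mul_assoc]
  have := hs.pred_lt_of_zero hd hn
  exact mul_le_mul hslope (by linarith) (by linarith) (ht.slope_pos hd n).le

/-- If two coded orbits agree at two consecutive times, they agree at all later times. -/
theorem eq_add_nat (ht : CodedOrbit d w t) (hs : CodedOrbit d w s) (hd : 0 < d) {n : ℤ}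
    (h0 : t n = s n) (h1 : t (n - 1) = s (n - 1)) (m : ℕ) :
    t (n + m) = s (n + m) ∧ t (n + m - 1) = s (n + m - 1) := by
  induction m with
  | zero => simpa using ⟨h0, h1⟩
  | succ m ih =>
    have e1 := ht.recurrence (n + m)
    have e2 := hs.recurrence (n + m)
    rw [ih.1, ih.2, ← e2] at e1
    have := mul_left_cancel₀ (hs.add_ne_zero hd _) e1
    push_cast
    rw [← add_assoc, add_sub_cancel_right]
    exact ⟨by linarith, ih.1⟩

theorem eq_of_eq (ht : CodedOrbit d w t) (hs : CodedOrbit d w s) (hd : 0 < d) {n : ℤ}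
    (h0 : t n = s n) (h1 : t (n - 1) = s (n - 1)) : t = s := by
  funext k
  rcases le_total n k with hk | hk
  · obtain ⟨m, rfl⟩ := Int.le.dest hk
    exact (ht.eq_add_nat hs hd h0 h1 m).1
  · obtain ⟨m, rfl⟩ := Int.le.dest hk
    have := (ht.reverse.eq_add_nat hs.reverse hd (n := 1 - (k + m))
      (by simpa [neg_add_eq_sub] using h1) (by simpa using h0) m).2
    rw [show 1 - (k + m : ℤ) + m - 1 = -k by ring] at this
    simpa using this

/-- Expanding cone condition on the pair of orbits `t`, `s` at time `n`. -/
structure Cone (d : ℝ) (t s : ℤ → ℝ) (n : ℤ) (r : ℝ) : Prop where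
  le : s n ≤ t n
  pred_le : t (n - 1) ≤ s (n - 1)
  slope_le : r * pencilSlope d s n ≤ pencilSlope d t n

theorem cone_succ (hadm : ∀ k : ℤ, ¬(w k = 1 ∧ w (k + 1) = 1)) (ht : CodedOrbit d w t)
    (hs : CodedOrbit d w s) (hd : 0 < d) {n : ℤ} {r : ℝ} (hr : 1 ≤ r) (hc : Cone d t s n r) :
    Cone d s t (n + 1) r := by
  have hslope : r * pencilSlope d t (n + 1) ≤ pencilSlope d s (n + 1) := by
    have := ht.slope_succ_le hs hd (q := 1) (by linarith) hc.slope_le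
      (by simpa using ht.slopeProd_le hs hd hc.le)
    simpa using this
  refine ⟨?_, by simpa using hc.le, hslope⟩
  rcases fin_two_cases (w (n + 1)) with h0 | h1
  · have := hs.mul_add_le ht hd h0 (by simpa using hc.le) hslope
    have := ht.gt_of_zero hd h0
    nlinarith
  · have hn : w n = 0 := (fin_two_cases (w n)).resolve_right fun h => hadm n ⟨h, h1⟩
    have a1 := ht.gt_of_succ_one n h1
    have b1 := hs.gt_of_succ_one n h1
    have a2 := ht.pred_lt_of_zero hd hn
    have b2 := hs.pred_lt_of_zero hd hn
    have e1 := ht.recurrence n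
    have e2 := hs.recurrence n
    have e1' : d + 1 + t (n + 1) = -((t n - d) / (t n + d) * (d + 1 - t (n - 1))) := by
      have : t n + d ≠ 0 := by linarith
      field_simp
      linarith
    have e2' : d + 1 + s (n + 1) = -((s n - d) / (s n + d) * (d + 1 - s (n - 1))) := by
      have : s n + d ≠ 0 := by linarith
      field_simp
      linarith
    have : (s n - d) / (s n + d) * (d + 1 - s (n - 1)) ≤
        (t n - d) / (t n + d) * (d + 1 - t (n - 1)) := by
      refine mul_le_mul ?_ (by linarith [hc.pred_le]) (by linarith)
        (div_nonneg (by linarith) (by linarith))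
      rw [div_le_div_iff₀ (by linarith) (by linarith)]
      nlinarith [hc.le]
    linarith

theorem cone_add_nat (hadm : ∀ k : ℤ, ¬(w k = 1 ∧ w (k + 1) = 1)) (ht : CodedOrbit d w t)
    (hs : CodedOrbit d w s) (hd : 0 < d) {n : ℤ} {r : ℝ} (hr : 1 ≤ r)
    (hc : Cone d t s n r ∨ Cone d s t n r) (m : ℕ) :
    Cone d t s (n + m) r ∨ Cone d s t (n + m) r := by
  induction m with
  | zero => simpa using hc
  | succ m ih =>
    push_cast
    rw [← add_assoc]
    exact ih.symm.imp (hs.cone_succ hadm ht hd hr) (ht.cone_succ hadm hs hd hr)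

theorem cone_succ_mul (hadm : ∀ k : ℤ, ¬(w k = 1 ∧ w (k + 1) = 1)) (ht : CodedOrbit d w t)
    (hs : CodedOrbit d w s) (hd : 0 < d) {n : ℤ} {r₀ r : ℝ} (hr₀ : 1 ≤ r₀) (hr : r₀ ≤ r)
    (h0 : w n = 0) (h1 : w (n + 1) = 0) (hc : Cone d t s n r) :
    Cone d s t (n + 1) (r * (1 + (r₀ - 1) / (2 * d * (2 * d + 1) ^ 2))) := by
  have hc' := ht.cone_succ hadm hs hd (hr₀.trans hr) hc
  refine ⟨hc'.le, hc'.pred_le, ht.slope_succ_le hs hd (by linarith) hc.slope_le ?_⟩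
  have hs0 := hs.mid_of_zero n h0 h1
  have ht0 := ht.mid_of_zero n h0 h1
  have hdiff := ht.mul_add_le hs hd h0 hc.pred_le hc.slope_le
  have hpos : 0 < slopeProd d (t n) :=
    div_pos (mul_pos (by linarith) (by linarith)) (slopeProd_den_pos ht0.1 ht0.2)
  refine le_trans (mul_le_mul_of_nonneg_left ?_ hpos.le) (slopeProd_quant hd hs0.1 hc.le ht0.2)
  have hdiff' : r₀ - 1 ≤ t n - s n := by
    nlinarith [mul_nonneg (show 0 ≤ r - 1 by linarith) (show 0 ≤ d + s n by linarith)]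
  have := div_le_div_of_nonneg_right hdiff' (show 0 ≤ 2 * d * (2 * d + 1) ^ 2 by positivity)
  linarith

/-- An expanding pair of orbits cannot return infinitely often to the middle interval. -/
theorem not_cone (hadm : ∀ k : ℤ, ¬(w k = 1 ∧ w (k + 1) = 1)) (ht : CodedOrbit d w t)
    (hs : CodedOrbit d w s) (hd : 0 < d)
    (htail : ∀ K : ℕ, ∃ n : ℤ, (K : ℤ) ≤ n ∧ w n = 0 ∧ w (n + 1) = 0) {n : ℤ} {r : ℝ}
    (hr : 1 < r) : ¬Cone d t s n r := by
  intro hc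
  set q : ℝ := 1 + (r - 1) / (2 * d * (2 * d + 1) ^ 2) with hq
  have hq1 : 1 < q := by
    have : 0 < (r - 1) / (2 * d * (2 * d + 1) ^ 2) := div_pos (by linarith) (by positivity)
    linarith
  have hrq (j : ℕ) : r ≤ r * q ^ j := le_mul_of_one_le_right (by linarith) (one_le_pow₀ hq1.le)
  have hnext {m : ℤ} {ρ : ℝ} (hρ : 1 ≤ ρ) (h : Cone d t s m ρ ∨ Cone d s t m ρ) :
      ∃ k, w k = 0 ∧ w (k + 1) = 0 ∧ (Cone d t s k ρ ∨ Cone d s t k ρ) := by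
    obtain ⟨k, hk, h0, h1⟩ := htail m.toNat
    obtain ⟨i, rfl⟩ := Int.le.dest ((Int.self_le_toNat m).trans hk)
    exact ⟨_, h0, h1, ht.cone_add_nat hadm hs hd hρ h i⟩
  have grow (j : ℕ) : ∃ m, Cone d t s m (r * q ^ j) ∨ Cone d s t m (r * q ^ j) := by
    induction j with
    | zero => exact ⟨n, by simpa using Or.inl hc⟩
    | succ j ih =>
      obtain ⟨m, hm⟩ := ih
      obtain ⟨k, h0, h1, hk⟩ := hnext (hr.le.trans (hrq j)) hm
      refine ⟨k + 1, ?_⟩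
      rw [pow_succ, ← mul_assoc]
      exact hk.symm.imp (hs.cone_succ_mul hadm ht hd hr.le (hrq j) h0 h1)
        (ht.cone_succ_mul hadm hs hd hr.le (hrq j) h0 h1)
  obtain ⟨j, hj⟩ := pow_unbounded_of_one_lt (2 * d + 1) hq1
  obtain ⟨m, hm⟩ := grow j
  have hbig : 2 * d + 1 < r * q ^ j := by
    have := pow_pos (zero_lt_one.trans hq1) j
    nlinarith
  obtain ⟨k, h0, h1, hk⟩ := hnext (hr.le.trans (hrq j)) hm
  have ht0 := ht.mid_of_zero k h0 h1
  have hs0 := hs.mid_of_zero k h0 h1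
  rcases hk with hk | hk
  · have := ht.mul_add_le hs hd h0 hk.pred_le hk.slope_le
    nlinarith
  · have := hs.mul_add_le ht hd h0 hk.pred_le hk.slope_le
    nlinarith

theorem slope_reverse (t : ℤ → ℝ) (n : ℤ) :
    pencilSlope d (fun k => -t (-k)) (1 - n) = (pencilSlope d t n)⁻¹ := by
  simp only [pencilSlope, inv_div]
  rw [show -(1 - n) = n - 1 by ring, show -(1 - n - 1) = n by ring]
  ring

theorem eq_of_le (hadm : ∀ k : ℤ, ¬(w k = 1 ∧ w (k + 1) = 1)) (ht : CodedOrbit d w t)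
    (hs : CodedOrbit d w s) (hd : 0 < d)
    (hfwd : ∀ K : ℕ, ∃ n : ℤ, (K : ℤ) ≤ n ∧ w n = 0 ∧ w (n + 1) = 0)
    (hbwd : ∀ K : ℕ, ∃ m : ℤ, (K : ℤ) ≤ m ∧ w (-m) = 0 ∧ w (-m + 1) = 0)
    {n : ℤ} (h0 : w n = 0) (h1 : w (n + 1) = 0) (hle : s n ≤ t n) : t = s := by
  have pt := ht.slope_pos hd n
  have ps := hs.slope_pos hd n
  have pt' := ht.slope_pos hd (n + 1)
  have ps' := hs.slope_pos hd (n + 1)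
  have ht0 := ht.mid_of_zero n h0 h1
  have hs0 := hs.mid_of_zero n h0 h1
  rcases lt_or_ge (pencilSlope d t n) (pencilSlope d s n) with hlt | hge
  · have hpred : t (n - 1) ≤ s (n - 1) := by
      have e1 := ht.slope_mul hd n
      have e2 := hs.slope_mul hd n
      have := ht.pred_lt_of_zero hd h0
      by_contra! hcon
      nlinarith [mul_lt_mul_of_pos_right hlt (show 0 < d + 1 - t (n - 1) by linarith),
        mul_pos ps (sub_pos.2 hcon)]
    refine absurd ?_ (ht.reverse.not_cone (w := fun k => w (1 - k)) (n := 1 - n)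
      (r := pencilSlope d s n / pencilSlope d t n) (fun k hk => hadm (-k) ?_) hs.reverse hd
      (fun K => ?_) ((one_lt_div pt).2 hlt))
    · refine ⟨by simpa [neg_add_eq_sub] using hpred, by simpa using hle, ?_⟩
      rw [slope_reverse, slope_reverse]
      field_simp
      exact le_rfl
    · rw [show 1 - (k + 1) = -k by ring] at hk
      rw [neg_add_eq_sub]
      exact hk.symm
    · obtain ⟨m, hm, g0, g1⟩ := hbwd K
      refine ⟨m, hm, by rwa [sub_eq_neg_add], by rwa [show 1 - (m + 1) = -m by ring]⟩
  · by_contra hne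
    have hq := slopeProd_quant hd hs0.1 hle ht0.2
    have hpos : 0 < slopeProd d (t n) :=
      div_pos (mul_pos (by linarith) (by linarith)) (slopeProd_den_pos ht0.1 ht0.2)
    have hnn : 0 ≤ (t n - s n) / (2 * d * (2 * d + 1) ^ 2) :=
      div_nonneg (by linarith) (by positivity)
    have hslope : pencilSlope d t (n + 1) < pencilSlope d s (n + 1) := by
      by_contra! hcon
      have e1 := ht.slope_succ_mul hd n
      have e2 := hs.slope_succ_mul hd n
      have hzero : (t n - s n) / (2 * d * (2 * d + 1) ^ 2) = 0 := by
        by_contra hz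
        have : 0 < (t n - s n) / (2 * d * (2 * d + 1) ^ 2) := lt_of_le_of_ne hnn (Ne.symm hz)
        nlinarith [mul_pos hpos this, mul_le_mul hcon hge ps.le pt'.le]
      have hts : t n = s n := by
        rw [div_eq_zero_iff] at hzero
        rcases hzero with h | h
        · linarith
        · exact absurd h (by positivity)
      have hsl : pencilSlope d t n = pencilSlope d s n := by
        rw [← hts, ← e1] at e2
        refine le_antisymm ?_ hge
        by_contra! hlt
        nlinarith [mul_lt_mul_of_pos_left hlt ps', mul_le_mul_of_nonneg_right hcon pt.le]
      refine hne (ht.eq_of_eq hs hd hts ?_)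
      have f1 := ht.slope_mul hd n
      have f2 := hs.slope_mul hd n
      rw [hsl, hts, ← f2] at f1
      linarith [mul_left_cancel₀ ps.ne' f1]
    have hc : Cone d s t (n + 1) (pencilSlope d s (n + 1) / pencilSlope d t (n + 1)) := by
      refine ⟨?_, by simpa using hle, (div_mul_cancel₀ _ pt'.ne').le⟩
      have := hs.mul_add_le ht hd h1 (r := 1) (by simpa using hle) (by simpa using hslope.le)
      linarith
    exact hs.not_cone hadm ht hd hfwd ((one_lt_div pt').2 hslope) hc

theorem unique (hadm : ∀ k : ℤ, ¬(w k = 1 ∧ w (k + 1) = 1)) (ht : CodedOrbit d w t)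
    (hs : CodedOrbit d w s) (hd : 0 < d)
    (hfwd : ∀ K : ℕ, ∃ n : ℤ, (K : ℤ) ≤ n ∧ w n = 0 ∧ w (n + 1) = 0)
    (hbwd : ∀ K : ℕ, ∃ m : ℤ, (K : ℤ) ≤ m ∧ w (-m) = 0 ∧ w (-m + 1) = 0) : t = s := by
  obtain ⟨n, -, h0, h1⟩ := hfwd 0
  rcases le_total (s n) (t n) with h | h
  · exact ht.eq_of_le hadm hs hd hfwd hbwd h0 h1 h
  · exact (hs.eq_of_le hadm ht hd hfwd hbwd h0 h1 h).symm

end CodedOrbit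

/-- A self-map of a box of bi-infinite sequences has a fixed point if each of its coordinates is
antitone in the two neighbours and monotone in the two second neighbours. -/
theorem exists_fixed_of_alternating {lo hi : ℤ → ℝ} (hle : lo ≤ hi) (F : (ℤ → ℝ) → ℤ → ℝ)
    (hmaps : ∀ x ∈ Set.Icc lo hi, F x ∈ Set.Icc lo hi)
    (hmono : ∀ x ∈ Set.Icc lo hi, ∀ y ∈ Set.Icc lo hi, ∀ n, x (n - 2) ≤ y (n - 2) →
      x (n + 2) ≤ y (n + 2) → y (n - 1) ≤ x (n - 1) → y (n + 1) ≤ x (n + 1) → F x n ≤ F y n) :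
    ∃ t ∈ Set.Icc lo hi, F t = t := by
  let σ (x : ℤ → ℝ) (n : ℤ) : ℝ := if Even n then x n else -x n
  let lo' (n : ℤ) : ℝ := if Even n then lo n else -hi n
  let hi' (n : ℤ) : ℝ := if Even n then hi n else -lo n
  have hσσ (x : ℤ → ℝ) : σ (σ x) = x := by
    funext n
    by_cases h : Even n <;> simp [σ, h]
  have hσ {x : ℤ → ℝ} (hx : x ∈ Set.Icc lo hi) : σ x ∈ Set.Icc lo' hi' := by
    constructor <;> intro n <;> have := hx.1 n <;> have := hx.2 n <;>
      by_cases h : Even n <;> simp [σ, lo', hi', *]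
  have hσ' {x : ℤ → ℝ} (hx : x ∈ Set.Icc lo' hi') : σ x ∈ Set.Icc lo hi := by
    constructor <;> intro n <;> have h1 := hx.1 n <;> have h2 := hx.2 n <;>
      by_cases h : Even n <;> simp only [σ, lo', hi', h, if_true, if_false] at * <;> linarith
  have : Fact (lo' ≤ hi') := by
    refine ⟨fun n => ?_⟩
    have := hle n
    by_cases h : Even n <;> simp [lo', hi', h, this]
  let G : Set.Icc lo' hi' →o Set.Icc lo' hi' :=
    { toFun := fun x => ⟨σ (F (σ x)), hσ (hmaps _ (hσ' x.2))⟩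
      monotone' := by
        intro x y hxy n
        have key (m : ℤ) : x.1 m ≤ y.1 m := hxy m
        have hx := hσ' x.2
        have hy := hσ' y.2
        have k1 := key (n - 2)
        have k2 := key (n + 2)
        have k3 := key (n - 1)
        have k4 := key (n + 1)
        by_cases h : Even n
        · have := hmono _ hx _ hy n
          simp only [σ, h, Int.even_add, Int.even_sub, Int.not_even_one, even_two, if_true,
            if_false, iff_false, not_true] at this ⊢
          exact this k1 k2 (by linarith) (by linarith)
        · have := hmono _ hy _ hx n
          simp only [σ, h, Int.even_add, Int.even_sub, Int.not_even_one, even_two, if_true,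
            if_false, iff_true] at this ⊢
          exact neg_le_neg (this (by linarith) (by linarith) k3 k4) }
  refine ⟨σ (OrderHom.lfp G).1, hσ' (OrderHom.lfp G).2, ?_⟩
  have h1 : σ (F (σ (OrderHom.lfp G).1)) = (OrderHom.lfp G).1 :=
    congrArg Subtype.val (OrderHom.map_lfp G)
  rw [← hσσ (F _), h1]

theorem exists_countdown (P : ℤ → Prop) (hP : ∀ n, ∃ m : ℕ, P (n + m)) (e δ : ℝ) (hδ : 0 ≤ δ) :
    ∃ b : ℤ → ℝ, (∀ n, e ≤ b n) ∧ ∀ n, ¬P n → b (n + 1) + δ ≤ b n := by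
  classical
  refine ⟨fun n => e + δ * Nat.find (hP n), fun n => ?_, fun n hn => ?_⟩
  · have : 0 ≤ δ * (Nat.find (hP n) : ℝ) := by positivity
    linarith
  · have hspec := Nat.find_spec (hP n)
    obtain ⟨j, hj⟩ : ∃ j, Nat.find (hP n) = j + 1 := by
      refine Nat.exists_eq_succ_of_ne_zero fun h0 => hn ?_
      simpa [h0] using hspec
    have hle : Nat.find (hP (n + 1)) ≤ j := by
      refine Nat.find_min' _ ?_
      rw [hj] at hspec
      push_cast at hspec
      rwa [add_assoc, add_comm (1 : ℤ)]
    have : (Nat.find (hP (n + 1)) : ℝ) + 1 ≤ Nat.find (hP n) := by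
      rw [hj]
      exact_mod_cast Nat.succ_le_succ hle
    nlinarith

/-- The non-strict version of `CodedOrbit`. -/
structure WeakCodedOrbit (d : ℝ) (w : ℤ → Fin 2) (t : ℤ → ℝ) : Prop where
  recurrence : ∀ n, (d + t n) * (d + 1 + t (n + 1)) = (d - t n) * (d + 1 - t (n - 1))
  le_of_one : ∀ n, w n = 1 → t n ≤ -(d + 1)
  ge_of_succ_one : ∀ n, w (n + 1) = 1 → d + 1 ≤ t n
  mid_of_zero : ∀ n, w n = 0 → w (n + 1) = 0 → -d ≤ t n ∧ t n ≤ d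

namespace WeakCodedOrbit

variable {d : ℝ} {w : ℤ → Fin 2} {t : ℤ → ℝ}

theorem ge_of_zero (h : WeakCodedOrbit d w t) (hd : 0 < d) {n : ℤ} (hn : w n = 0) : -d ≤ t n := by
  rcases fin_two_cases (w (n + 1)) with h0 | h1
  · exact (h.mid_of_zero n hn h0).1
  · linarith [h.ge_of_succ_one n h1]

theorem pred_le_of_zero (h : WeakCodedOrbit d w t) (hd : 0 < d) {n : ℤ} (hn : w n = 0) :
    t (n - 1) ≤ d := by
  have hn' : w (n - 1 + 1) = 0 := by simpa using hn
  rcases fin_two_cases (w (n - 1)) with h0 | h1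
  · exact (h.mid_of_zero _ h0 hn').2
  · linarith [h.le_of_one _ h1]

theorem codedOrbit (h : WeakCodedOrbit d w t) (hadm : ∀ k : ℤ, ¬(w k = 1 ∧ w (k + 1) = 1))
    (hd : 0 < d) : CodedOrbit d w t where
  recurrence := h.recurrence
  lt_of_one n hn := by
    refine lt_of_le_of_ne (h.le_of_one n hn) fun heq => ?_
    have hp : w (n - 1) = 0 := (fin_two_cases _).resolve_right fun h1 => hadm (n - 1)
      ⟨h1, by simpa using hn⟩
    have e := h.recurrence (n - 1)
    have h1 := h.ge_of_succ_one (n - 1) (by simpa using hn)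
    have h2 := h.pred_le_of_zero hd hp
    rw [sub_add_cancel, heq] at e
    nlinarith [mul_pos (show 0 < t (n - 1) - d by linarith)
      (show 0 < d + 1 - t (n - 1 - 1) by linarith)]
  gt_of_succ_one n hn := by
    refine lt_of_le_of_ne (h.ge_of_succ_one n hn) fun heq => ?_
    have hp : w (n + 1 + 1) = 0 := (fin_two_cases _).resolve_right fun h1 => hadm (n + 1) ⟨hn, h1⟩
    have e := h.recurrence (n + 1)
    have h1 := h.le_of_one (n + 1) hn
    have h2 := h.ge_of_zero hd hp
    rw [add_sub_cancel_right, ← heq] at e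
    nlinarith [mul_pos (show 0 < -d - t (n + 1) by linarith)
      (show 0 < d + 1 + t (n + 1 + 1) by linarith)]
  mid_of_zero n h0 h1 := by
    obtain ⟨hl, hr⟩ := h.mid_of_zero n h0 h1
    have e := h.recurrence n
    have h2 := h.ge_of_zero hd h1
    have h3 := h.pred_le_of_zero hd h0
    refine ⟨lt_of_le_of_ne hl fun heq => ?_, lt_of_le_of_ne hr fun heq => ?_⟩
    · rw [← heq] at e
      nlinarith
    · rw [heq] at e
      nlinarith

end WeakCodedOrbit

/-- The amount by which the recurrence at a point `x`, preceded by `u`, overshoots `-(d + 1)`. -/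
noncomputable def overshoot (d x u : ℝ) : ℝ := (x - d) / (x + d) * (d + 1 - u)

/-- The recurrence of coded orbits, solved at each time for the variable for which the solution
operator preserves the intervals prescribed by `w`. -/
noncomputable def codedStep (d : ℝ) (w : ℤ → Fin 2) (t : ℤ → ℝ) (n : ℤ) : ℝ :=
  if w n = 1 then -(d + 1) - overshoot d (t (n - 1)) (t (n - 2))
  else if w (n + 1) = 1 then d + 1 + overshoot d (-t (n + 1)) (-t (n + 2))
  else -(d * (t (n - 1) + t (n + 1))) / (2 * (d + 1) - t (n - 1) + t (n + 1))

theorem overshoot_le_overshoot {d x y u v : ℝ} (hd : 0 < d) (hx : d + 1 ≤ x) (hxy : x ≤ y)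
    (hu : u ≤ d) (hvu : v ≤ u) : overshoot d x u ≤ overshoot d y v := by
  refine mul_le_mul ?_ (by linarith) (by linarith) (div_nonneg (by linarith) (by linarith))
  rw [div_le_div_iff₀ (by linarith) (by linarith)]
  nlinarith

theorem overshoot_nonneg {d x u : ℝ} (hd : 0 < d) (hx : d + 1 ≤ x) (hu : u ≤ d) :
    0 ≤ overshoot d x u :=
  mul_nonneg (div_nonneg (by linarith) (by linarith)) (by linarith)

theorem overshoot_le {d x u : ℝ} (hd : 0 < d) (hx : d + 1 ≤ x) (hu : u ≤ d) :
    overshoot d x u ≤ d + 1 - u :=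
  mul_le_of_le_one_left (by linarith) ((div_le_one (by linarith)).2 (by linarith))

theorem middle_step_anti {d x y u v : ℝ} (hd : 0 < d) (hx : x ≤ d) (hu : u ≤ x) (hy : -d ≤ v)
    (hvy : v ≤ y) :
    -(d * (x + y)) / (2 * (d + 1) - x + y) ≤ -(d * (u + v)) / (2 * (d + 1) - u + v) := by
  rw [div_le_div_iff₀ (by linarith) (by linarith)]
  have h1 : 0 ≤ d * ((y - v) * (d + 1 - x)) :=
    mul_nonneg hd.le (mul_nonneg (by linarith) (by linarith))
  have h2 : 0 ≤ d * ((x - u) * (d + 1 + v)) :=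
    mul_nonneg hd.le (mul_nonneg (by linarith) (by linarith))
  nlinarith

theorem middle_step_mem {d x y : ℝ} (hd : 0 < d) (hx : x ≤ d) (hy : -d ≤ y) :
    -d ≤ -(d * (x + y)) / (2 * (d + 1) - x + y) ∧ -(d * (x + y)) / (2 * (d + 1) - x + y) ≤ d := by
  rw [le_div_iff₀ (by linarith), div_le_iff₀ (by linarith)]
  constructor <;> nlinarith

/-- A fixed point of `codedStep` satisfies the recurrence. -/
theorem recurrence_of_codedStep_eq {d : ℝ} {w : ℤ → Fin 2} {t : ℤ → ℝ} (hd : 0 < d)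
    (hadm : ∀ k : ℤ, ¬(w k = 1 ∧ w (k + 1) = 1))
    (hone : ∀ n, w n = 1 → t n ≤ -(d + 1)) (hsucc : ∀ n, w (n + 1) = 1 → d + 1 ≤ t n)
    (hmid : ∀ n, w n = 0 → w (n + 1) = 0 → t (n - 1) ≤ d ∧ -d ≤ t (n + 1))
    (hfix : codedStep d w t = t) (n : ℤ) :
    (d + t n) * (d + 1 + t (n + 1)) = (d - t n) * (d + 1 - t (n - 1)) := by
  rcases fin_two_cases (w (n + 1)) with h1 | h1
  · rcases fin_two_cases (w n) with h0 | h0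
    · have e := congrFun hfix n
      obtain ⟨hl, hr⟩ := hmid n h0 h1
      have hD : 2 * (d + 1) - t (n - 1) + t (n + 1) ≠ 0 := by linarith
      simp only [codedStep, h0, h1, zero_ne_one, if_false] at e
      rw [div_eq_iff hD] at e
      linarith
    · have e := congrFun hfix (n - 1)
      have h2 : w (n - 1) ≠ 1 := fun h => hadm (n - 1) ⟨h, by simpa using h0⟩
      have hD : -t n + d ≠ 0 := by linarith [hone n h0]
      simp only [codedStep, sub_add_cancel, h2, h0, if_false, if_true, overshoot] at e
      rw [show n - 1 + 2 = n + 1 by ring] at e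
      field_simp at e
      linarith
  · have e := congrFun hfix (n + 1)
    have hD : t n + d ≠ 0 := by linarith [hsucc n h1]
    simp only [codedStep, h1, if_true, add_sub_cancel_right, overshoot] at e
    rw [show n + 1 - 2 = n - 1 by ring] at e
    field_simp at e
    linarith

theorem exists_weakCodedOrbit {d : ℝ} {w : ℤ → Fin 2} (hd : 0 < d)
    (hadm : ∀ k : ℤ, ¬(w k = 1 ∧ w (k + 1) = 1))
    (hfwd : ∀ K : ℕ, ∃ n : ℤ, (K : ℤ) ≤ n ∧ w n = 0 ∧ w (n + 1) = 0)
    (hbwd : ∀ K : ℕ, ∃ m : ℤ, (K : ℤ) ≤ m ∧ w (-m) = 0 ∧ w (-m + 1) = 0) :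
    ∃ t, WeakCodedOrbit d w t := by
  obtain ⟨b, hb, hbstep⟩ := exists_countdown (fun n => w n = 0 ∧ w (n + 1) = 0) (fun n => by
    obtain ⟨k, hk, h⟩ := hfwd n.toNat
    obtain ⟨m, rfl⟩ := Int.le.dest ((Int.self_le_toNat n).trans hk)
    exact ⟨m, h⟩) d (2 * (d + 1)) (by linarith)
  obtain ⟨b', hb', hbstep'⟩ := exists_countdown (fun n => w (-n) = 0 ∧ w (-n + 1) = 0) (fun n => by
    obtain ⟨k, hk, h⟩ := hbwd n.toNat
    obtain ⟨m, rfl⟩ := Int.le.dest ((Int.self_le_toNat n).trans hk)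
    exact ⟨m, h⟩) d (2 * (d + 1)) (by linarith)
  have hbs (n : ℤ) (hn : w n = 1 ∨ w (n + 1) = 1) : b (n + 1) + 2 * (d + 1) ≤ b n :=
    hbstep n fun h => by simp [h.1, h.2] at hn
  have hbs' (n : ℤ) (hn : w n = 1 ∨ w (n + 1) = 1) : b' (-(n - 1)) + 2 * (d + 1) ≤ b' (-n) := by
    have := hbstep' (-n) fun h => by
      rw [neg_neg] at h
      simp [h.1, h.2] at hn
    rwa [show -(n - 1) = -n + 1 by ring]
  let lo (n : ℤ) : ℝ := if w n = 1 then -b' (-n) else if w (n + 1) = 1 then d + 1 else -d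
  let hi (n : ℤ) : ℝ := if w n = 1 then -(d + 1) else if w (n + 1) = 1 then b n else d
  have hsucc0 {n : ℤ} (h : w n = 1) : w (n + 1) = 0 :=
    (fin_two_cases _).resolve_right fun h1 => hadm n ⟨h, h1⟩
  have hpred0 {n : ℤ} (h : w (n + 1) = 1) : w n = 0 :=
    (fin_two_cases _).resolve_right fun h1 => hadm n ⟨h1, h⟩
  have box1 {x} (hx : x ∈ Set.Icc lo hi) {n : ℤ} (h : w n = 1) :
      -b' (-n) ≤ x n ∧ x n ≤ -(d + 1) := by
    simpa [lo, hi, h] using And.intro (hx.1 n) (hx.2 n)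
  have box01 {x} (hx : x ∈ Set.Icc lo hi) {n : ℤ} (h : w (n + 1) = 1) :
      d + 1 ≤ x n ∧ x n ≤ b n := by
    simpa [lo, hi, h, hpred0 h] using And.intro (hx.1 n) (hx.2 n)
  have box00 {x} (hx : x ∈ Set.Icc lo hi) {n : ℤ} (h0 : w n = 0) (h1 : w (n + 1) = 0) :
      -d ≤ x n ∧ x n ≤ d := by
    simpa [lo, hi, h0, h1] using And.intro (hx.1 n) (hx.2 n)
  have box0 {x} (hx : x ∈ Set.Icc lo hi) {n : ℤ} (h : w n = 0) : -d ≤ x n ∧ x n ≤ b n := by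
    rcases fin_two_cases (w (n + 1)) with h1 | h1
    · have := box00 hx h h1
      exact ⟨this.1, this.2.trans (hb n)⟩
    · have := box01 hx h1
      exact ⟨by linarith, this.2⟩
  have boxs0 {x} (hx : x ∈ Set.Icc lo hi) {n : ℤ} (h : w (n + 1) = 0) :
      -b' (-n) ≤ x n ∧ x n ≤ d := by
    rcases fin_two_cases (w n) with h1 | h1
    · have := box00 hx h1 h
      exact ⟨by linarith [hb' (-n)], this.2⟩
    · have := box1 hx h1
      exact ⟨this.1, by linarith⟩
  have hle : lo ≤ hi := by
    intro n
    simp only [lo, hi]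
    split_ifs with h h'
    · have := hbs' n (.inl h)
      have := hb' (-(n - 1))
      linarith
    · have := hbs n (.inr h')
      have := hb (n + 1)
      linarith
    · linarith
  have hmaps : ∀ x ∈ Set.Icc lo hi, codedStep d w x ∈ Set.Icc lo hi := by
    intro x hx
    suffices ∀ n, lo n ≤ codedStep d w x n ∧ codedStep d w x n ≤ hi n from
      ⟨fun n => (this n).1, fun n => (this n).2⟩
    intro n
    simp only [lo, hi, codedStep]
    split_ifs with h h'
    · have h1 := box01 hx (n := n - 1) (by simpa using h)
      have h2 := boxs0 hx (n := n - 2)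
        (by rw [show n - 2 + 1 = n - 1 by ring]; exact hpred0 (by simpa using h))
      have b1 := hbs' n (.inl h)
      have b2 := hbs' (n - 1) (.inr (by simpa using h))
      rw [show n - 1 - 1 = n - 2 by ring] at b2
      have := overshoot_nonneg hd h1.1 h2.2
      have := overshoot_le hd h1.1 h2.2
      constructor <;> linarith
    · have h1 := box1 hx h'
      have h2 := box0 hx (n := n + 2)
        (by rw [show n + 2 = n + 1 + 1 by ring]; exact hsucc0 h')
      have b1 := hbs n (.inr h')
      have b2 := hbs (n + 1) (.inl h')
      rw [show n + 1 + 1 = n + 2 by ring] at b2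
      have := overshoot_nonneg (x := -x (n + 1)) (u := -x (n + 2)) hd (by linarith) (by linarith)
      have := overshoot_le (x := -x (n + 1)) (u := -x (n + 2)) hd (by linarith) (by linarith)
      constructor <;> linarith
    · have h0 := (fin_two_cases _).resolve_right h
      exact middle_step_mem hd (boxs0 hx (by simpa using h0)).2
        (box0 hx ((fin_two_cases _).resolve_right h')).1
  have hmono : ∀ x ∈ Set.Icc lo hi, ∀ y ∈ Set.Icc lo hi, ∀ n, x (n - 2) ≤ y (n - 2) →
      x (n + 2) ≤ y (n + 2) → y (n - 1) ≤ x (n - 1) → y (n + 1) ≤ x (n + 1) →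
      codedStep d w x n ≤ codedStep d w y n := by
    intro x hx y hy n k1 k2 k3 k4
    simp only [codedStep]
    split_ifs with h h'
    · have h1 := box01 hy (n := n - 1) (by simpa using h)
      have h2 := boxs0 hy (n := n - 2)
        (by rw [show n - 2 + 1 = n - 1 by ring]; exact hpred0 (by simpa using h))
      linarith [overshoot_le_overshoot hd h1.1 k3 h2.2 k1]
    · have h1 := box1 hx h'
      have h2 := box0 hx (n := n + 2)
        (by rw [show n + 2 = n + 1 + 1 by ring]; exact hsucc0 h')
      have := overshoot_le_overshoot (x := -x (n + 1)) (y := -y (n + 1)) (u := -x (n + 2))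
        (v := -y (n + 2)) hd (by linarith) (by linarith) (by linarith) (by linarith)
      linarith
    · have h0 := (fin_two_cases _).resolve_right h
      exact middle_step_anti hd (boxs0 hx (by simpa using h0)).2 k3
        (box0 hy ((fin_two_cases _).resolve_right h')).1 k4
  obtain ⟨t, ht, hfix⟩ := exists_fixed_of_alternating hle (codedStep d w) hmaps hmono
  have hbounds (n : ℤ) (h0 : w n = 0) (h1 : w (n + 1) = 0) : t (n - 1) ≤ d ∧ -d ≤ t (n + 1) :=
    ⟨(boxs0 ht (by simpa using h0)).2, (box0 ht h1).1⟩
  have hone (n : ℤ) (h : w n = 1) := (box1 ht h).2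
  have hsucc (n : ℤ) (h : w (n + 1) = 1) := (box01 ht h).1
  exact ⟨t, recurrence_of_codedStep_eq hd hadm hone hsucc hbounds hfix, hone, hsucc,
    fun n h0 h1 => box00 ht h0 h1⟩

/-- The orbits of `birat a` with itinerary `w` give weakly coded orbits. -/
theorem weakCodedOrbit_of_orbit {a : ℝ} {w : ℤ → Fin 2}
    {p : ℤ → ℝ × ℝ} (horb : ∀ n : ℤ, (p n).1 ≠ 1 ∧ p (n + 1) = birat a (p n))
    (hR : ∀ n : ℤ, p n ∈ Rw (w n)) :
    WeakCodedOrbit ((-a - 1) / 2) w (fun n => (p n).1 - (1 - a) / 2) := by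
  have hsnd (n : ℤ) : (p (n + 1)).2 = (p n).1 + a - 1 := by rw [(horb n).2, birat]
  have hone {n : ℤ} (h : w n = 1) : (p n).1 ≤ 0 ∧ 0 ≤ (p n).2 := by
    simpa [Rw, Rone, h] using hR n
  have hzero {n : ℤ} (h : w n = 0) : 1 ≤ (p n).1 ∧ (p n).2 ≤ -1 := by
    simpa [Rw, Rzero, h] using hR n
  refine ⟨fun n => ?_, fun n h => ?_, fun n h => ?_, fun n h0 h1 => ?_⟩
  · have h1 := sub_ne_zero.2 (horb n).1
    have h2 := congrArg Prod.fst (horb n).2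
    have h3 := hsnd (n - 1)
    simp only [birat] at h2
    rw [sub_add_cancel] at h3
    rw [eq_div_iff h1, h3] at h2
    linear_combination h2
  · linarith [(hone h).1]
  · linarith [(hone h).2, hsnd n]
  · have := hsnd n
    constructor <;> linarith [(hzero h0).1, (hzero h1).2]

theorem CodedOrbit.orbit {a : ℝ} (ha : a < -1) {w : ℤ → Fin 2} {t : ℤ → ℝ}
    (ht : CodedOrbit ((-a - 1) / 2) w t) :
    (∀ n : ℤ, t n + (1 - a) / 2 ≠ 1 ∧
      (t (n + 1) + (1 - a) / 2, t (n + 1 - 1) - (1 - a) / 2) =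
        birat a (t n + (1 - a) / 2, t (n - 1) - (1 - a) / 2)) ∧
    ∀ n : ℤ, (t n + (1 - a) / 2, t (n - 1) - (1 - a) / 2) ∈ Rw (w n) := by
  have hd : 0 < (-a - 1) / 2 := by linarith
  refine ⟨fun n => ?_, fun n => ?_⟩
  · have h1 := ht.add_ne_zero hd n
    have h2 : t n + (1 - a) / 2 - 1 ≠ 0 := fun h => h1 (by linarith)
    refine ⟨fun h => h2 (by linarith), ?_⟩
    simp only [birat, add_sub_cancel_right, Prod.mk.injEq]
    refine ⟨?_, by ring⟩
    rw [eq_div_iff h2]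
    linear_combination ht.recurrence n
  · rcases fin_two_cases (w n) with h | h
    · have := ht.gt_of_zero hd h
      have := ht.pred_lt_of_zero hd h
      simp only [Rw, h, if_true, Rzero, Set.mem_ofPred_eq]
      constructor <;> linarith
    · have := ht.lt_of_one n h
      have := ht.pred_gt_of_one h
      simp only [Rw, h, one_ne_zero, if_false, Rone, Set.mem_ofPred_eq]
      constructor <;> linarith

theorem stmt14 (a : ℝ) (ha : a < -1) (w : ℤ → Fin 2)
    (hadm : ∀ k : ℤ, ¬(w k = 1 ∧ w (k + 1) = 1))
    (htails : ∀ K : ℕ, (∃ n : ℤ, (K : ℤ) ≤ n ∧ w n = 0 ∧ w (n + 1) = 0) ∧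
      (∃ m : ℤ, (K : ℤ) ≤ m ∧ w (-m) = 0 ∧ w (-m + 1) = 0)) :
    ∃! p : ℤ → ℝ × ℝ,
      (∀ n : ℤ, (p n).1 ≠ 1 ∧ p (n + 1) = birat a (p n)) ∧
      (∀ n : ℤ, p n ∈ Rw (w n)) := by
  have hd : 0 < (-a - 1) / 2 := by linarith
  have hfwd (K : ℕ) := (htails K).1
  have hbwd (K : ℕ) := (htails K).2
  obtain ⟨t, ht⟩ := exists_weakCodedOrbit hd hadm hfwd hbwd
  have ht := ht.codedOrbit hadm hd
  refine ⟨fun n => (t n + (1 - a) / 2, t (n - 1) - (1 - a) / 2), ht.orbit ha, fun p hp => ?_⟩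
  have hs := (weakCodedOrbit_of_orbit hp.1 hp.2).codedOrbit hadm hd
  have heq := hs.unique hadm ht hd hfwd hbwd
  funext n
  have h1 : (p n).1 - (1 - a) / 2 = t n := congrFun heq n
  have h2 : (p (n - 1)).1 - (1 - a) / 2 = t (n - 1) := congrFun heq (n - 1)
  have h3 : (p n).2 = (p (n - 1)).1 + a - 1 := by
    have := (hp.1 (n - 1)).2
    rw [sub_add_cancel] at this
    rw [this, birat]
  ext
  · simp only
    linarith
  · simp only
    linarith
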